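/- Let f : S^m → ℝ^m be a continuous odd map with m odd, m ≥ 2. Then there exist a pair of antipodal points p₀, -p₀ with f(p₀) = f(-p₀) = 0, and also a pair of non-antipodal distinct points p₁, p₂ (p₁ ≠ ±p₂) with f(p₁) = f(p₂). -/

import Mathlib

namespace BU

abbrev Ch (X : Type) := List X →₀ ZMod 2

variable {X : Type}

noncomputable def cone (v : X) : Ch X →ₗ[ZMod 2] Ch X :=
  Finsupp.lmapDomain _ _ (List.cons v)

noncomputable def mp (g : X → X) : Ch X →ₗ[ZMod 2] Ch X :=
  Finsupp.lmapDomain _ _ (List.map g)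

noncomputable def bdL : List X → Ch X
  | [] => 0
  | v :: σ => Finsupp.single σ 1 + cone v (bdL σ)

noncomputable def bd : Ch X →ₗ[ZMod 2] Ch X := Finsupp.linearCombination _ bdL

noncomputable def prL (g h : X → X) : List X → Ch X
  | [] => 0
  | v :: σ => Finsupp.single (g v :: h v :: σ.map h) 1 + cone (g v) (prL g h σ)

noncomputable def pr (g h : X → X) : Ch X →ₗ[ZMod 2] Ch X :=
  Finsupp.linearCombination _ (prL g h)

/-- the basis chain -/
noncomputable def e (σ : List X) : Ch X := Finsupp.single σ 1

lemma cone_e (v : X) (σ : List X) : cone v (e σ) = e (v :: σ) := by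
  simp [cone, e, Finsupp.mapDomain_single]
lemma mp_e (g : X → X) (σ : List X) : mp g (e σ) = e (σ.map g) := by
  simp [mp, e, Finsupp.mapDomain_single]
lemma bd_nil : bd (e ([] : List X)) = 0 := by simp [bd, e, bdL]
lemma bd_cons (v : X) (σ : List X) : bd (e (v :: σ)) = e σ + cone v (bd (e σ)) := by
  simp [bd, e, bdL]
lemma pr_nil (g h : X → X) : pr g h (e ([] : List X)) = 0 := by simp [pr, e, prL]
lemma pr_cons (g h : X → X) (v : X) (σ : List X) :
    pr g h (e (v :: σ)) = e (g v :: h v :: σ.map h) + cone (g v) (pr g h (e σ)) := by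
  simp [pr, e, prL]

lemma ext_e {M : Type*} [AddCommGroup M] [Module (ZMod 2) M] {f g : Ch X →ₗ[ZMod 2] M}
    (H : ∀ σ, f (e σ) = g (e σ)) (c : Ch X) : f c = g c := by
  have : f = g := by
    apply Finsupp.lhom_ext'
    intro σ
    ext
    simpa [e] using H σ
  rw [this]

lemma two (c : Ch X) : c + c = 0 := by
  rw [← two_smul (ZMod 2) c]
  have : (2 : ZMod 2) = 0 := by decide
  rw [this, zero_smul]

lemma bd_cone (v : X) (c : Ch X) : bd (cone v c) = c + cone v (bd c) := by
  have := ext_e (f := bd ∘ₗ cone v) (g := LinearMap.id + cone v ∘ₗ bd)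
    (fun σ => by simp [cone_e, bd_cons]) c
  simpa using this

lemma pr_cone (g h : X → X) (v : X) (c : Ch X) :
    pr g h (cone v c) = cone (g v) (cone (h v) (mp h c)) + cone (g v) (pr g h c) := by
  have := ext_e (f := pr g h ∘ₗ cone v)
    (g := cone (g v) ∘ₗ cone (h v) ∘ₗ mp h + cone (g v) ∘ₗ pr g h)
    (fun σ => by simp [cone_e, pr_cons, mp_e]) c
  simpa using this

lemma mp_cone (g : X → X) (v : X) (c : Ch X) : mp g (cone v c) = cone (g v) (mp g c) := by
  have := ext_e (f := mp g ∘ₗ cone v) (g := cone (g v) ∘ₗ mp g)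
    (fun σ => by simp [cone_e, mp_e]) c
  simpa using this

lemma bd_mp (g : X → X) (c : Ch X) : bd (mp g c) = mp g (bd c) := by
  refine ext_e (f := bd ∘ₗ mp g) (g := mp g ∘ₗ bd) (fun σ => ?_) c
  induction σ with
  | nil => simp [mp_e, bd_nil]
  | cons v σ ih =>
    simp only [LinearMap.comp_apply, mp_e, List.map_cons, bd_cons, map_add, mp_cone] at ih ⊢
    rw [ih]

lemma bd_bd (c : Ch X) : bd (bd c) = 0 := by
  refine ext_e (f := bd ∘ₗ bd) (g := 0) (fun σ => ?_) c
  induction σ with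
  | nil => simp [bd_nil]
  | cons v σ ih =>
    simp only [LinearMap.comp_apply, bd_cons, map_add, bd_cone, LinearMap.zero_apply] at ih ⊢
    rw [ih, map_zero, add_zero, two]

lemma bd_pr (g h : X → X) (c : Ch X) :
    bd (pr g h c) + pr g h (bd c) = mp g c + mp h c := by
  refine ext_e (f := bd ∘ₗ pr g h + pr g h ∘ₗ bd) (g := mp g + mp h) (fun σ => ?_) c
  induction σ with
  | nil => simp [bd_nil, pr_nil, mp_e, two]
  | cons v σ ih =>
    simp only [LinearMap.comp_apply, LinearMap.add_apply, mp_e] at ih ⊢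
    have h1 : cone (g v) (bd (pr g h (e σ))) =
        cone (g v) (e (σ.map g)) + cone (g v) (e (σ.map h)) + cone (g v) (pr g h (bd (e σ))) := by
      rw [← map_add, ← map_add, ← ih, add_assoc, two, add_zero]
    simp only [pr_cons, bd_cons, map_add, bd_cone, pr_cone, List.map_cons, h1, cone_e, ← mp_e,
      bd_mp, mp_cone]
    simp only [mp_e, cone_e, List.map_cons]
    generalize pr g h (e σ) = A
    generalize e (g v :: List.map g σ) = B
    generalize e (h v :: List.map h σ) = C
    generalize e (g v :: List.map h σ) = D
    generalize cone (g v) (cone (h v) (mp h (bd (e σ)))) = E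
    generalize cone (g v) (pr g h (bd (e σ))) = F
    have hA := two A
    have hD := two D
    have hE := two E
    have hF := two F
    have : C + (D + E) + (A + (B + D + F)) + (A + (E + F)) =
      B + C + (D + D) + (E + E) + (F + F) + (A + A) := by abel
    rw [this, hA, hD, hE, hF]; simp

lemma fill (g : ℕ → X → X) (N : ℕ) (c : Ch X) (hc : bd c = 0) :
    bd (∑ i ∈ Finset.range N, pr (g i) (g (i+1)) c) = mp (g 0) c + mp (g N) c := by
  induction N with
  | zero => simp [two]
  | succ N ih =>
    rw [Finset.sum_range_succ, map_add, ih]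
    have := bd_pr (g N) (g (N+1)) c
    rw [hc, map_zero, add_zero] at this
    rw [this]
    have h2 := two (mp (g N) c)
    rw [show mp (g 0) c + mp (g N) c + (mp (g N) c + mp (g (N+1)) c) =
      mp (g 0) c + (mp (g N) c + mp (g N) c) + mp (g (N+1)) c by abel, h2, add_zero]

/-- cup product of coboundaries of the functions in the first list -/
def wL : List (X → ZMod 2) → List X → ZMod 2
  | [], [_] => 1
  | s :: ss, u :: v :: σ => (s u + s v) * wL ss (v :: σ)
  | _, _ => 0

noncomputable def W (ss : List (X → ZMod 2)) : Ch X →ₗ[ZMod 2] ZMod 2 :=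
  Finsupp.linearCombination _ (wL ss)

def phL (s : X → ZMod 2) (ss : List (X → ZMod 2)) : List X → ZMod 2
  | [] => 0
  | v :: σ => s v * wL ss (v :: σ)

noncomputable def ph (s : X → ZMod 2) (ss : List (X → ZMod 2)) : Ch X →ₗ[ZMod 2] ZMod 2 :=
  Finsupp.linearCombination _ (phL s ss)

lemma W_e (ss : List (X → ZMod 2)) (σ : List X) : W ss (e σ) = wL ss σ := by simp [W, e]
lemma ph_e (s) (ss : List (X → ZMod 2)) (σ : List X) : ph s ss (e σ) = phL s ss σ := by
  simp [ph, e]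
lemma ph_cone (s) (ss : List (X → ZMod 2)) (v : X) (c : Ch X) :
    ph s ss (cone v c) = s v * W ss (cone v c) := by
  have := ext_e (f := ph s ss ∘ₗ cone v) (g := s v • (W ss ∘ₗ cone v))
    (fun σ => by simp [cone_e, ph_e, W_e, phL]) c
  simpa using this

lemma W_of (s) (ss : List (X → ZMod 2)) (H : ∀ c, W ss (bd c) = 0) (c : Ch X) :
    W (s :: ss) c = ph s ss (bd c) := by
  refine ext_e (f := W (s :: ss)) (g := ph s ss ∘ₗ bd) (fun σ => ?_) c
  rcases σ with _ | ⟨u, _ | ⟨v, σ⟩⟩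
  · simp [bd_nil, W_e, wL]
  · simp [bd_cons, bd_nil, W_e, ph_e, wL, phL]
  · have h1 := H (e (u :: v :: σ))
    rw [LinearMap.comp_apply]
    rw [bd_cons u] at h1 ⊢
    rw [map_add] at h1 ⊢
    rw [ph_cone, ph_e, phL]
    rw [W_e] at h1 ⊢
    rw [wL]
    generalize W ss ((cone u) (bd (e (v :: σ)))) = B at *
    generalize wL ss (v :: σ) = A at *
    generalize s u = p
    generalize s v = q
    revert A B p q
    decide

lemma W_bd (ss : List (X → ZMod 2)) (c : Ch X) : W ss (bd c) = 0 := by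
  induction ss generalizing c with
  | nil =>
    refine ext_e (f := W [] ∘ₗ bd) (g := 0) (fun σ => ?_) c
    rcases σ with _ | ⟨u, _ | ⟨v, _ | ⟨w, σ⟩⟩⟩
    · simp [bd_nil]
    · simp [bd_nil, bd_cons, W_e, wL]
    · simp [bd_nil, bd_cons, W_e, wL, cone_e]; decide
    · have : ∀ c : Ch X, W [] (cone u (cone v c)) = 0 := fun c =>
        ext_e (f := W [] ∘ₗ cone u ∘ₗ cone v) (g := 0)
          (fun σ => by simp [cone_e, W_e, wL]) c
      simp [bd_cons, W_e, wL, cone_e, this]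
  | cons s ss ih => rw [W_of s ss ih, bd_bd, map_zero]

lemma wL_map (A : X → Prop) (a : X → X) (ss : List (X → ZMod 2)) (hs : ∀ s ∈ ss, ∀ x, A x → s (a x) = s x + 1)
    (σ : List X) (hσ : ∀ x ∈ σ, A x) : wL ss (σ.map a) = wL ss σ := by
  induction ss generalizing σ with
  | nil => rcases σ with _ | ⟨u, _ | ⟨v, σ⟩⟩ <;> simp [wL]
  | cons s ss ih =>
    rcases σ with _ | ⟨u, _ | ⟨v, σ⟩⟩
    · simp [wL]
    · simp [wL]
    · have := ih (fun s h => hs s (by simp [h])) (v :: σ) (fun x hx => hσ x (List.mem_cons_of_mem _ hx))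
      simp only [List.map_cons, wL] at this ⊢
      rw [this, hs s (by simp) u (hσ u (by simp)), hs s (by simp) v (hσ v (by simp))]
      congr 1
      generalize s u = p
      generalize s v = q
      revert p q
      decide

/-- chains supported on the lists satisfying `P` -/
def Sup (P : List X → Prop) : Submodule (ZMod 2) (Ch X) :=
  Finsupp.supported (ZMod 2) (ZMod 2) {σ | P σ}

lemma e_mem {P : List X → Prop} {σ : List X} (h : P σ) : e σ ∈ Sup P :=
  Finsupp.single_mem_supported _ _ h

lemma Sup_map {P Q : List X → Prop} (T : Ch X →ₗ[ZMod 2] Ch X)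
    (H : ∀ σ, P σ → T (e σ) ∈ Sup Q) (c : Ch X) (hc : c ∈ Sup P) : T c ∈ Sup Q := by
  have : Sup P ≤ (Sup Q).comap T := by
    unfold Sup
    rw [Finsupp.supported_eq_span_single, Submodule.span_le]
    rintro _ ⟨σ, hσ, rfl⟩
    exact H σ hσ
  exact this hc

lemma ext_sup {P : List X → Prop} {M : Type*} [AddCommGroup M] [Module (ZMod 2) M]
    {f g : Ch X →ₗ[ZMod 2] M}
    (H : ∀ σ, P σ → f (e σ) = g (e σ)) (c : Ch X) (hc : c ∈ Sup P) : f c = g c := by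
  have : Sup P ≤ LinearMap.eqLocus f g := by
    unfold Sup
    rw [Finsupp.supported_eq_span_single, Submodule.span_le]
    rintro _ ⟨σ, hσ, rfl⟩
    exact H σ hσ
  exact this hc

lemma W_step (A : X → Prop) (a : X → X) (s) (ss : List (X → ZMod 2))
    (hs : ∀ t ∈ s :: ss, ∀ x, A x → t (a x) = t x + 1) (c d : Ch X)
    (hc : c ∈ Sup (fun σ => ∀ x ∈ σ, A x)) (hd : bd d = c + mp a c) : W (s :: ss) d = W ss c := by
  rw [W_of s ss (W_bd ss), hd]
  refine ext_sup (f := ph s ss ∘ₗ (LinearMap.id + mp a)) (g := W ss) (fun σ hσ => ?_) c hc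
  simp only [LinearMap.comp_apply, LinearMap.add_apply, LinearMap.id_apply, map_add, mp_e,
    ph_e, W_e]
  have hss : ∀ t ∈ ss, ∀ x, A x → t (a x) = t x + 1 := fun t h => hs t (by simp [h])
  rcases σ with _ | ⟨v, σ⟩
  · rcases ss with _ | ⟨_, _⟩ <;> simp [phL, wL]
  · have := wL_map A a ss hss (v :: σ) hσ
    simp only [List.map_cons, phL] at this ⊢
    rw [this, hs s (by simp) v (hσ v (by simp))]
    generalize wL ss (v :: σ) = A
    generalize s v = q
    revert A q
    decide

lemma prL_mem (g h : X → X) (σ : List X) :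
    pr g h (e σ) ∈ Sup (fun τ => ∀ x ∈ τ, ∃ y ∈ σ, x = g y ∨ x = h y) := by
  induction σ with
  | nil => rw [pr_nil]; exact Submodule.zero_mem _
  | cons v σ ih =>
    rw [pr_cons]
    refine Submodule.add_mem _ (e_mem ?_) (Sup_map _ (fun τ hτ => ?_) _ ih)
    · intro x hx
      simp only [List.mem_cons, List.mem_map] at hx
      rcases hx with rfl | rfl | ⟨y, hy, rfl⟩
      · exact ⟨v, by simp, Or.inl rfl⟩
      · exact ⟨v, by simp, Or.inr rfl⟩
      · exact ⟨y, by simp [hy], Or.inr rfl⟩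
    · rw [cone_e]
      apply e_mem
      intro x hx
      rcases List.mem_cons.1 hx with rfl | hx
      · exact ⟨v, by simp, Or.inl rfl⟩
      · obtain ⟨y, hy, h⟩ := hτ x hx
        exact ⟨y, by simp [hy], h⟩

lemma exists_of_W {P : List X → Prop} (ss : List (X → ZMod 2)) (c : Ch X) (hc : c ∈ Sup P)
    (h : W ss c ≠ 0) : ∃ σ, P σ ∧ wL ss σ ≠ 0 := by
  by_contra hcon
  push Not at hcon
  apply h
  have : Sup P ≤ LinearMap.ker (W ss) := by
    unfold Sup
    rw [Finsupp.supported_eq_span_single, Submodule.span_le]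
    rintro _ ⟨σ, hσ, rfl⟩
    have := W_e ss σ
    rw [hcon σ hσ] at this
    exact this
  exact this hc

lemma change_of_wL (ss : List (X → ZMod 2)) (σ : List X) (h : wL ss σ ≠ 0) :
    σ ≠ [] ∧ ∀ s ∈ ss, ∃ u ∈ σ, ∃ v ∈ σ, s u ≠ s v := by
  induction ss generalizing σ with
  | nil => rcases σ with _ | ⟨u, σ⟩ <;> simp [wL] at h ⊢
  | cons s ss ih =>
    rcases σ with _ | ⟨u, _ | ⟨v, σ⟩⟩
    · simp [wL] at h
    · simp [wL] at h
    · rw [wL] at h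
      refine ⟨by simp, fun t ht => ?_⟩
      rcases List.mem_cons.1 ht with rfl | ht
      · refine ⟨u, by simp, v, by simp, fun huv => ?_⟩
        apply h
        rw [huv, show t v + t v = 0 by generalize t v = q; revert q; decide, zero_mul]
      · obtain ⟨x, hx, y, hy, hxy⟩ := (ih _ (right_ne_zero_of_mul h)).2 t ht
        exact ⟨x, List.mem_cons_of_mem _ hx, y, List.mem_cons_of_mem _ hy, hxy⟩


def PP {n : ℕ} (k : ℕ) (x : Fin n → ℝ) : Prop := ∑ i, |x i| = 1 ∧ ∀ i : Fin n, k < i.val → x i = 0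

def Good {n : ℕ} (k : ℕ) (δ : ℝ) (σ : List (Fin n → ℝ)) : Prop :=
  (∀ x ∈ σ, PP k x) ∧ ∀ x ∈ σ, ∀ y ∈ σ, dist x y ≤ δ

lemma mp_id (g : X → X) (hg : ∀ x, g x = x) (c : Ch X) : mp g c = c :=
  ext_e (f := mp g) (g := LinearMap.id)
    (fun σ => by
      have : σ.map g = σ := by rw [show g = id from funext hg]; simp
      rw [mp_e, this]; rfl) c

lemma mp_mp (g h : X → X) (c : Ch X) : mp g (mp h c) = mp (g ∘ h) c :=
  ext_e (f := mp g ∘ₗ mp h) (g := mp (g ∘ h)) (fun σ => by simp [mp_e]) c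

lemma mp_neg {n : ℕ} (c : Ch (Fin n → ℝ)) : mp Neg.neg (mp Neg.neg c) = c := by
  rw [mp_mp, mp_id]; simp

noncomputable def hh {n : ℕ} (p : Fin n → ℝ) (t : ℝ) (x : Fin n → ℝ) : Fin n → ℝ :=
  (1 - t) • x + t • p

lemma PP_norm {n k : ℕ} {x : Fin n → ℝ} (h : PP k x) : ‖x‖ ≤ 1 := by
  rw [pi_norm_le_iff_of_nonneg zero_le_one]
  intro i
  rw [← h.1]
  exact Finset.single_le_sum (f := fun i => |x i|) (fun i _ => abs_nonneg _) (Finset.mem_univ i)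

lemma PP_single {n k : ℕ} (hk : k < n) : PP k (Pi.single ⟨k, hk⟩ 1 : Fin n → ℝ) := by
  constructor
  · rw [Finset.sum_eq_single ⟨k, hk⟩]
    · simp
    · intro b _ hb; simp [Pi.single_apply, hb]
    · simp
  · intro i hi
    have : i ≠ ⟨k, hk⟩ := by rintro rfl; simp at hi
    simp [Pi.single_apply, this]

lemma PP_hh {n k : ℕ} (hk : k + 1 < n) {x : Fin n → ℝ} (hx : PP k x) {t : ℝ} (h0 : 0 ≤ t)
    (h1 : t ≤ 1) : PP (k+1) (hh (Pi.single ⟨k+1, hk⟩ 1) t x) := by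
  have hp := PP_single hk
  set p : Fin n → ℝ := Pi.single ⟨k+1, hk⟩ 1 with hpd
  constructor
  · have : ∀ i, |hh p t x i| = (1 - t) * |x i| + t * |p i| := by
      intro i
      simp only [hh, Pi.add_apply, Pi.smul_apply, smul_eq_mul]
      by_cases hi : i = ⟨k+1, hk⟩
      · have : x i = 0 := hx.2 i (by rw [hi]; simp)
        rw [this]; simp [abs_mul, abs_of_nonneg h0]
      · have : p i = 0 := by simp [hpd, Pi.single_apply, hi]
        rw [this]; simp [abs_mul, abs_of_nonneg (sub_nonneg.2 h1)]
    simp_rw [this]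
    rw [Finset.sum_add_distrib, ← Finset.mul_sum, ← Finset.mul_sum, hx.1, hp.1]
    ring
  · intro i hi
    simp [hh, hx.2 i (by omega), hp.2 i hi]

lemma dist_hh {n k : ℕ} {p x y : Fin n → ℝ} (hp : ‖p‖ ≤ 1) (hy : ‖y‖ ≤ 1)
    {s t δ η : ℝ} (hxy : dist x y ≤ δ)
    (h0 : 0 ≤ s) (h1 : s ≤ 1) (hst : |s - t| ≤ η) : dist (hh p s x) (hh p t y) ≤ δ + 2 * η := by
  have e1 : hh p s x - hh p t y = (1 - s) • (x - y) + (s - t) • (p - y) := by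
    simp only [hh]; module
  rw [dist_eq_norm] at hxy ⊢
  rw [e1]
  refine (norm_add_le _ _).trans ?_
  rw [norm_smul, norm_smul, Real.norm_eq_abs, Real.norm_eq_abs, abs_of_nonneg (sub_nonneg.2 h1)]
  have : ‖p - y‖ ≤ 2 := (norm_sub_le _ _).trans (by linarith)
  have a1 : (1 - s) * ‖x - y‖ ≤ 1 * ‖x - y‖ := by gcongr; linarith
  have a2 : |s - t| * ‖p - y‖ ≤ η * 2 := by gcongr; exact (abs_nonneg _).trans hst
  linarith

lemma hemi {n : ℕ} (k : ℕ) (hk : k < n) : ∀ δ : ℝ, 0 < δ →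
    ∃ c : Ch (Fin n → ℝ), c ∈ Sup (Good k δ) ∧ bd (c + mp Neg.neg c) = 0 ∧
      ∀ ss : List ((Fin n → ℝ) → ZMod 2), ss.length = k →
        (∀ s ∈ ss, ∀ x, x ≠ 0 → s (-x) = s x + 1) → W ss c = 1 := by
  induction k with
  | zero =>
    intro δ hδ
    refine ⟨e [Pi.single ⟨0, hk⟩ 1], e_mem ⟨?_, ?_⟩, ?_, ?_⟩
    · intro x hx
      rw [List.mem_singleton.1 hx]
      exact PP_single hk
    · intro x hx y hy
      rw [List.mem_singleton.1 hx, List.mem_singleton.1 hy, dist_self]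
      exact hδ.le
    · simp [mp_e, bd_cons, bd_nil, two]
    · intro ss hss _
      rw [List.length_eq_zero_iff.1 hss, W_e, wL]
  | succ k ih =>
    intro δ hδ
    obtain ⟨c, hc, hz, hW⟩ := ih (by omega) (δ/2) (by linarith)
    set z := c + mp Neg.neg c with hzd
    have hzm : z ∈ Sup (Good k (δ/2)) := by
      refine Submodule.add_mem _ hc (Sup_map _ (fun σ hσ => ?_) c hc)
      rw [mp_e]
      apply e_mem
      constructor
      · intro x hx
        obtain ⟨y, hy, rfl⟩ := List.mem_map.1 hx
        exact ⟨by simpa using (hσ.1 y hy).1, fun i hi => by simpa using (hσ.1 y hy).2 i hi⟩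
      · intro x hx x' hx'
        obtain ⟨y, hy, rfl⟩ := List.mem_map.1 hx
        obtain ⟨y', hy', rfl⟩ := List.mem_map.1 hx'
        rw [dist_neg_neg]
        exact hσ.2 y hy y' hy'
    set p : Fin n → ℝ := Pi.single ⟨k+1, hk⟩ 1 with hpd
    have hp : PP (k+1) p := PP_single hk
    obtain ⟨N, hN⟩ := exists_nat_gt (4/δ)
    have hN0 : (0:ℝ) < N := lt_trans (by positivity) hN
    have hN2 : 2 * (1 / (N:ℝ)) ≤ δ / 2 := by
      rw [div_lt_iff₀ hδ] at hN
      rw [mul_one_div, div_le_iff₀ hN0]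
      linarith
    let g : ℕ → (Fin n → ℝ) → (Fin n → ℝ) := fun i => hh p ((i:ℝ)/N)
    have hg0 : mp (g 0) z = z := mp_id _ (fun x => by simp [g, hh]) z
    have hgN : ∀ x, g N x = p := fun x => by simp [g, hh, div_self hN0.ne']
    have hbd : bd (∑ i ∈ Finset.range N, pr (g i) (g (i+1)) z + cone p (mp (g N) z)) = z := by
      rw [map_add, fill g N z hz, hg0, bd_cone, bd_mp, hz, map_zero, map_zero, add_zero,
        add_assoc, two, add_zero]
    refine ⟨∑ i ∈ Finset.range N, pr (g i) (g (i+1)) z + cone p (mp (g N) z), ?_, ?_, ?_⟩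
    · refine Submodule.add_mem _ (Submodule.sum_mem _ fun i hi => ?_) ?_
      · have hi' : i + 1 ≤ N := Finset.mem_range.1 hi
        have hiN : ((i+1 : ℕ) : ℝ) ≤ N := by exact_mod_cast hi'
        refine Sup_map _ (fun σ hσ => ?_) z hzm
        refine Sup_map LinearMap.id (fun τ hτ => e_mem ?_) _ (prL_mem (g i) (g (i+1)) σ)
        have key : ∀ x ∈ τ, ∃ y ∈ σ, ∃ t : ℝ, x = hh p t y ∧ (i:ℝ)/N ≤ t ∧ t ≤ ((i+1 : ℕ):ℝ)/N := by
          intro x hx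
          have hle : (i:ℝ)/N ≤ ((i+1 : ℕ):ℝ)/N := by gcongr; simp
          obtain ⟨y, hy, h | h⟩ := hτ x hx
          · exact ⟨y, hy, _, h, le_rfl, hle⟩
          · exact ⟨y, hy, _, h, hle, le_rfl⟩
        have hi0 : 0 ≤ (i:ℝ)/N := by positivity
        have hi1 : ((i+1 : ℕ):ℝ)/N ≤ 1 := by rw [div_le_one hN0]; exact hiN
        constructor
        · intro x hx
          obtain ⟨y, hy, t, rfl, ht0, ht1⟩ := key x hx
          exact PP_hh hk (hσ.1 y hy) (hi0.trans ht0) (ht1.trans hi1)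
        · intro x hx x' hx'
          obtain ⟨y, hy, t, rfl, ht0, ht1⟩ := key x hx
          obtain ⟨y', hy', t', rfl, ht0', ht1'⟩ := key x' hx'
          have hst : |t - t'| ≤ 1 / N := by
            have : ((i+1 : ℕ):ℝ)/N = (i:ℝ)/N + 1/N := by push_cast; ring
            rw [this] at ht1 ht1'
            rw [abs_le]; constructor <;> linarith
          have := dist_hh (k := k) (PP_norm hp) (PP_norm (hσ.1 y' hy')) (hσ.2 y hy y' hy')
            (hi0.trans ht0) (ht1.trans hi1) hst
          linarith
      · refine Sup_map (cone p ∘ₗ mp (g N)) (fun σ hσ => ?_) z hzm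
        rw [LinearMap.comp_apply, mp_e, cone_e]
        apply e_mem
        have key : ∀ x ∈ p :: σ.map (g N), x = p := by
          intro x hx
          rcases List.mem_cons.1 hx with rfl | hx
          · rfl
          · obtain ⟨y, hy, rfl⟩ := List.mem_map.1 hx
            exact hgN y
        constructor
        · intro x hx; rw [key x hx]; exact hp
        · intro x hx y hy; rw [key x hx, key y hy, dist_self]; exact hδ.le
    · rw [map_add, bd_mp, hbd, hzd, map_add, mp_neg]
      rw [add_comm (mp Neg.neg c) c, two]
    · intro ss hss hs
      rcases ss with _ | ⟨s, ss⟩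
      · simp at hss
      · have hc' : c ∈ Sup (fun σ : List (Fin n → ℝ) => ∀ x ∈ σ, x ≠ 0) :=
          Sup_map LinearMap.id (fun σ hσ => e_mem fun x hx h0 => by
            have := (hσ.1 x hx).1
            simp [h0] at this) c hc
        rw [W_step (fun x => x ≠ 0) Neg.neg s ss hs c _ hc' hbd]
        exact hW ss (by simpa using hss) (fun t ht => hs t (by simp [ht]))

/-- Borsuk–Ulam on the l1 sphere -/
lemma bu (m : ℕ) (F : (Fin (m+1) → ℝ) → (Fin m → ℝ))
    (hF : ContinuousOn F {x | ∑ i, |x i| = 1}) (ho : ∀ x, F (-x) = - F x) :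
    ∃ x, ∑ i, |x i| = 1 ∧ F x = 0 := by
  classical
  by_contra hcon
  push Not at hcon
  set K : Set (Fin (m+1) → ℝ) := {x | ∑ i, |x i| = 1} with hK
  have hKc : IsCompact K := by
    apply Metric.isCompact_of_isClosed_isBounded
    · exact isClosed_eq (by fun_prop) continuous_const
    · apply (Metric.isBounded_closedBall (x := (0 : Fin (m+1) → ℝ)) (r := 1)).subset
      intro x hx
      rw [mem_closedBall_zero_iff]
      exact PP_norm (k := m+1) ⟨hx, fun i hi => by omega⟩
  have hKne : K.Nonempty := ⟨_, (PP_single (n := m+1) (k := 0) (by omega)).1⟩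
  obtain ⟨x0, hx0, hmin⟩ := hKc.exists_isMinOn hKne hF.norm
  have hε : 0 < ‖F x0‖ := norm_pos_iff.2 (hcon x0 hx0)
  set ε := ‖F x0‖ with hεd
  have huc := hKc.uniformContinuousOn_of_continuous hF
  rw [Metric.uniformContinuousOn_iff] at huc
  obtain ⟨δ, hδ, hu⟩ := huc (ε/2) (by linarith)
  obtain ⟨c, hc, -, hW⟩ := hemi (n := m+1) m (by omega) (δ/2) (by linarith)
  -- a tie-breaking odd function
  let r : (Fin (m+1) → ℝ) → Prop := fun x => WellOrderingRel x (-x)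
  have hr : ∀ x, x ≠ 0 → (r (-x) ↔ ¬ r x) := by
    intro x hx
    have hne : x ≠ -x := fun h => hx (self_eq_neg.1 h)
    simp only [r, neg_neg]
    constructor
    · intro h h'
      exact asymm_of WellOrderingRel h h'
    · intro h
      rcases trichotomous_of WellOrderingRel x (-x) with h' | h' | h'
      · exact absurd h' h
      · exact absurd h' hne
      · exact h'
  let s : Fin m → (Fin (m+1) → ℝ) → ZMod 2 := fun i x =>
    if 0 < F x i then 1 else if F x i < 0 then 0 else if r x then 1 else 0
  have hs : ∀ i x, x ≠ 0 → s i (-x) = s i x + 1 := by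
    intro i x hx
    have h11 : (1 : ZMod 2) + 1 = 0 := by decide
    simp only [s, ho, Pi.neg_apply, hr x hx, Left.neg_pos_iff, Left.neg_neg_iff]
    rcases lt_trichotomy (F x i) 0 with h | h | h
    · simp [h, h.not_gt]
    · by_cases h' : r x <;> simp [h, h', h11]
    · simp [h, h.not_gt, h11]
  have hW1 := hW (List.ofFn s) (by simp) (by
    intro t ht
    obtain ⟨i, rfl⟩ := (List.mem_ofFn' _ _).1 ht
    exact hs i)
  obtain ⟨σ, hσ, hw⟩ := exists_of_W _ c hc (by rw [hW1]; decide)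
  obtain ⟨hne, hch⟩ := change_of_wL _ σ hw
  obtain ⟨x, hx⟩ := List.exists_mem_of_ne_nil σ hne
  have hclose : ∀ u ∈ σ, ∀ i, |F x i - F u i| < ε/2 := by
    intro u hu' i
    have h1 := hu x (hσ.1 x hx).1 u (hσ.1 u hu').1 ((hσ.2 x hx u hu').trans_lt (by linarith))
    have h2 := dist_le_pi_dist (F x) (F u) i
    rw [Real.dist_eq] at h2
    linarith
  have hlt : ∀ i, |F x i| < ε/2 := by
    intro i
    obtain ⟨u, hu', v, hv, huv⟩ := hch (s i) ((List.mem_ofFn' _ _).2 ⟨i, rfl⟩)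
    have cu := abs_lt.1 (hclose u hu' i)
    have cv := abs_lt.1 (hclose v hv i)
    have hsg : (F u i ≤ 0 ∧ 0 ≤ F v i) ∨ (0 ≤ F u i ∧ F v i ≤ 0) := by
      by_contra hno
      apply huv
      rcases lt_trichotomy (F u i) 0 with h | h | h <;> rcases lt_trichotomy (F v i) 0 with h' | h' | h' <;>
        first
        | (exfalso; apply hno; first
            | exact Or.inl ⟨by linarith, by linarith⟩
            | exact Or.inr ⟨by linarith, by linarith⟩)
        | simp [s, h, h', h.not_gt, h'.not_gt]
    rw [abs_lt]
    rcases hsg with h | h <;> constructor <;> linarith [h.1, h.2]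
  have h1 : ‖F x‖ ≤ ε/2 := (pi_norm_le_iff_of_nonneg (by linarith)).2 fun i => (hlt i).le
  have h2 : ε ≤ ‖F x‖ := hmin (hσ.1 x hx).1
  linarith

lemma eq_zero_of {n : ℕ} {x : EuclideanSpace ℝ (Fin n)} (h : x = -x) : x = 0 := by
  ext i
  have h1 : x i = (-x) i := by rw [← h]
  rw [PiLp.neg_apply] at h1
  have h2 : x i = 0 := by linarith
  simpa using h2

/-- Borsuk–Ulam -/
lemma borsuk_ulam (m : ℕ)
    (f : Metric.sphere (0 : EuclideanSpace ℝ (Fin (m+1))) 1 → EuclideanSpace ℝ (Fin m))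
    (hf : Continuous f) (hodd : ∀ p, f (-p) = -f p) : ∃ p, f p = 0 := by
  have hn : ∀ x : EuclideanSpace ℝ (Fin (m+1)), x ≠ 0 →
      ‖x‖⁻¹ • x ∈ Metric.sphere (0 : EuclideanSpace ℝ (Fin (m+1))) 1 := by
    intro x hx
    rw [mem_sphere_zero_iff_norm, norm_smul, norm_inv, norm_norm,
      inv_mul_cancel₀ (norm_ne_zero_iff.2 hx)]
  classical
  let G : EuclideanSpace ℝ (Fin (m+1)) → EuclideanSpace ℝ (Fin m) := fun x =>
    if h : x = 0 then 0 else f ⟨‖x‖⁻¹ • x, hn x h⟩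
  have hGv : ∀ x (h : x ≠ 0), G x = f ⟨‖x‖⁻¹ • x, hn x h⟩ := fun x h => dif_neg h
  have hGc : ContinuousOn G {x | x ≠ 0} := by
    rw [continuousOn_iff_continuous_restrict]
    have hc1 : Continuous (fun x : {x : EuclideanSpace ℝ (Fin (m+1)) | x ≠ 0} => ‖x.1‖) :=
      continuous_norm.comp continuous_subtype_val
    have hc2 := hc1.inv₀ (fun x => norm_ne_zero_iff.2 x.2)
    have hc3 := hc2.smul continuous_subtype_val
    have hc4 := hf.comp (hc3.subtype_mk (fun x => hn x.1 x.2))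
    refine hc4.congr fun x => ?_
    exact (hGv x.1 x.2).symm
  have hGo : ∀ x, G (-x) = - G x := by
    intro x
    by_cases h : x = 0
    · simp [G, h]
    · rw [hGv x h, hGv (-x) (neg_ne_zero.2 h)]
      rw [← hodd]
      congr 1
      ext1
      simp
  obtain ⟨x, hx, hx0⟩ := bu m (fun x => WithLp.ofLp (G (WithLp.toLp 2 x))) (by
      apply (PiLp.continuous_ofLp 2 _).comp_continuousOn
      apply hGc.comp (PiLp.continuous_toLp 2 _).continuousOn
      intro x hx h0
      have : x = 0 := by simpa using h0
      simp [this] at hx) (fun x => by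
      rw [WithLp.toLp_neg, hGo]; rfl)
  have hxne : WithLp.toLp 2 x ≠ 0 := by
    intro h0
    have : x = 0 := by simpa using h0
    simp [this] at hx
  refine ⟨⟨_, hn _ hxne⟩, ?_⟩
  have h3 : G (WithLp.toLp 2 x) = 0 := by
    ext i
    exact congrFun hx0 i
  rw [← hGv _ hxne]
  exact h3

end BU

theorem stmt_3 (m : ℕ) (hm : Odd m) (h2 : 2 ≤ m)
    (f : Metric.sphere (0 : EuclideanSpace ℝ (Fin (m+1))) 1 → EuclideanSpace ℝ (Fin m))
    (hf : Continuous f) (hodd : ∀ p, f (-p) = -f p) :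
    (∃ p₀ : Metric.sphere (0 : EuclideanSpace ℝ (Fin (m+1))) 1,
      f p₀ = 0 ∧ f (-p₀) = 0) ∧
    (∃ p₁ p₂ : Metric.sphere (0 : EuclideanSpace ℝ (Fin (m+1))) 1,
      p₁ ≠ p₂ ∧ p₁ ≠ -p₂ ∧ f p₁ = f p₂) := by
  constructor
  · obtain ⟨p, hp⟩ := BU.borsuk_ulam m f hf hodd
    exact ⟨p, hp, by rw [hodd, hp, neg_zero]⟩
  · -- the complex structure
    have hm1 : ∃ j, m = 2 * j + 1 := hm
    let sw : Fin (m+1) → Fin (m+1) := fun i =>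
      if h : i.val % 2 = 0 then ⟨i.val + 1, by have := i.2; omega⟩ else ⟨i.val - 1, by omega⟩
    have hsw : ∀ i, sw (sw i) = i := by
      intro i
      apply Fin.ext
      by_cases h : i.val % 2 = 0
      · have : (i.val + 1) % 2 ≠ 0 := by omega
        simp [sw, h, this]
      · have : (i.val - 1) % 2 = 0 := by omega
        simp [sw, h, this]; omega
    have hpar : ∀ i, (sw i).val % 2 = 0 ↔ ¬ (i.val % 2 = 0) := by
      intro i
      by_cases h : i.val % 2 = 0
      · simp [sw, h]; omega
      · simp [sw, h]; omega
    let ep : Fin (m+1) → ℝ := fun i => if i.val % 2 = 0 then 1 else -1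
    have hep : ∀ i, ep (sw i) = - ep i := by
      intro i
      by_cases h : i.val % 2 = 0 <;> simp [ep, hpar, h]
    have hep2 : ∀ i, ep i * ep i = 1 := by
      intro i
      by_cases h : i.val % 2 = 0 <;> simp [ep, h]
    let J : EuclideanSpace ℝ (Fin (m+1)) → EuclideanSpace ℝ (Fin (m+1)) := fun x =>
      WithLp.toLp 2 (fun i => ep i * x (sw i))
    have hJJ : ∀ x, J (J x) = -x := by
      intro x
      ext i
      simp only [J, hsw, hep, PiLp.neg_apply]
      linear_combination (- x i) * hep2 i
    have hJneg : ∀ x, J (-x) = - J x := by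
      intro x; ext i; simp [J]
    have hJn : ∀ x, ‖J x‖ = ‖x‖ := by
      intro x
      rw [EuclideanSpace.norm_eq, EuclideanSpace.norm_eq]
      congr 1
      have : ∀ i, ‖(J x) i‖ ^ 2 = ‖x (sw i)‖ ^ 2 := by
        intro i
        simp only [J, Real.norm_eq_abs, sq_abs]
        linear_combination (x (sw i))^2 * hep2 i
      simp_rw [this]
      exact Equiv.sum_comp (⟨sw, sw, hsw, hsw⟩ : Fin (m+1) ≃ Fin (m+1)) (fun i => ‖x i‖^2)
    have hJc : Continuous J := by
      apply (PiLp.continuous_toLp 2 _).comp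
      fun_prop
    let Js : Metric.sphere (0 : EuclideanSpace ℝ (Fin (m+1))) 1 →
        Metric.sphere (0 : EuclideanSpace ℝ (Fin (m+1))) 1 := fun p =>
      ⟨J p.1, by rw [mem_sphere_zero_iff_norm, hJn]; exact mem_sphere_zero_iff_norm.1 p.2⟩
    have hJsc : Continuous Js := (hJc.comp continuous_subtype_val).subtype_mk _
    have hJsn : ∀ p, Js (-p) = - Js p := fun p => Subtype.ext (hJneg p.1)
    obtain ⟨p, hp⟩ := BU.borsuk_ulam m (fun p => f p - f (Js p)) (hf.sub (hf.comp hJsc))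
      (fun p => by simp only [hJsn, hodd]; abel)
    have hpne : p.1 ≠ 0 := by
      intro h
      have := mem_sphere_zero_iff_norm.1 p.2
      rw [h] at this
      simp at this
    refine ⟨p, Js p, ?_, ?_, sub_eq_zero.1 hp⟩
    · intro h
      have h1 : p.1 = J p.1 := congrArg Subtype.val h
      have h3 := hJJ p.1
      rw [← h1, ← h1] at h3
      exact hpne (BU.eq_zero_of h3)
    · intro h
      have h1 : p.1 = - J p.1 := congrArg Subtype.val h
      have h4 : J p.1 = - p.1 := neg_eq_iff_eq_neg.1 h1.symm
      have h3 := hJJ p.1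
      rw [h4, hJneg, h4, neg_neg] at h3
      exact hpne (BU.eq_zero_of h3)
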